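/- arXiv:2409.05157 — 2 statements merged into one kernel-verified Lean document; each statement's English description precedes it below -/
import Mathlib

section
/- Fix p ≥ 1 and q, r ≥ 0 with (p−1)² + q² + r² > 0, and set C = (p + q/2 + r/4)^{(q+r)/p}. Define Ψ(t) = (1/C) · t^{1 − 1/p} · log^{q/p}(1+t) · log^{r/p}(1 + log(1+t)) for t ≥ 0 and Φ_{p,q,r}(t) = t^p · log^q(1+t) · log^r(1 + log(1+t)). Then for all a ≥ 0 and y ≥ 0, a · Ψ(y) ≤ Φ_{p,q,r}(a) + y. (Equivalently, a·b ≤ Φ_{p,q,r}(a) + Ψ^{−1}(b) for all a, b ≥ 0, where Ψ^{−1} is the inverse of Ψ.) -/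
open Real

/-- The logarithm satisfies `log (1 + t) ≤ √t`. -/
lemma log_one_add_le_rpow_half {t : ℝ} (ht : 0 ≤ t) : log (1 + t) ≤ t ^ (1 / 2 : ℝ) := by
  rw [← sqrt_eq_rpow, log_le_iff_le_exp (by linarith)]
  have hx := sqrt_nonneg t
  have h := sum_le_exp_of_nonneg hx 4
  simp only [Finset.sum_range_succ, Finset.sum_range_zero, Nat.factorial] at h
  norm_num at h
  have hsq := sq_sqrt ht
  nlinarith [mul_nonneg hx (sq_nonneg (√t - 3 / 2))]

lemma log_one_add_nonneg {t : ℝ} (ht : 0 ≤ t) : 0 ≤ log (1 + t) :=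
  log_nonneg (by linarith)

lemma log_one_add_mono {s t : ℝ} (hs : 0 ≤ s) (hst : s ≤ t) : log (1 + s) ≤ log (1 + t) :=
  log_le_log (by linarith) (by linarith)

lemma log_one_add_log_one_add_le_rpow {t : ℝ} (ht : 0 ≤ t) :
    log (1 + log (1 + t)) ≤ t ^ (1 / 4 : ℝ) := by
  calc log (1 + log (1 + t)) ≤ log (1 + t) ^ (1 / 2 : ℝ) :=
        log_one_add_le_rpow_half (log_one_add_nonneg ht)
    _ ≤ (t ^ (1 / 2 : ℝ)) ^ (1 / 2 : ℝ) :=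
        rpow_le_rpow (log_one_add_nonneg ht) (log_one_add_le_rpow_half ht) (by norm_num)
    _ = t ^ (1 / 4 : ℝ) := by rw [← rpow_mul ht]; norm_num

/-- Bernoulli's inequality in logarithmic form. -/
lemma log_one_add_mul_le {K x : ℝ} (hK : 1 ≤ K) (hx : 0 ≤ x) :
    log (1 + K * x) ≤ K * log (1 + x) := by
  rw [← log_rpow (by linarith)]
  exact log_le_log (by positivity) (one_add_mul_self_le_rpow_one_add (by linarith) hK)

/-- The logarithmic part of `Φ_{p,q,r}` is monotone. -/
lemma log_rpow_mul_loglog_rpow_mono {q r s t : ℝ} (hq : 0 ≤ q) (hr : 0 ≤ r) (hs : 0 ≤ s)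
    (hst : s ≤ t) :
    log (1 + s) ^ q * log (1 + log (1 + s)) ^ r ≤
      log (1 + t) ^ q * log (1 + log (1 + t)) ^ r := by
  have h1 := log_one_add_nonneg hs
  have h2 := log_one_add_nonneg h1
  have h3 := log_one_add_mono hs hst
  have h4 := log_one_add_mono h1 h3
  have h5 := h1.trans h3
  gcongr

lemma rpow_mul_log_rpow_mul_loglog_rpow_le {p q r t : ℝ} (hp : 0 ≤ p) (hq : 0 ≤ q) (hr : 0 ≤ r)
    (ht : 0 ≤ t) :
    t ^ p * (log (1 + t) ^ q * log (1 + log (1 + t)) ^ r) ≤ t ^ (p + q / 2 + r / 4) := by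
  have h1 := log_one_add_nonneg ht
  have h2 := log_one_add_nonneg h1
  have e : t ^ (p + q / 2 + r / 4) =
      t ^ p * ((t ^ (1 / 2 : ℝ)) ^ q * (t ^ (1 / 4 : ℝ)) ^ r) := by
    rw [← rpow_mul ht, ← rpow_mul ht, rpow_add_of_nonneg ht (by positivity) (by positivity),
      rpow_add_of_nonneg ht (by positivity) (by positivity), mul_assoc]
    ring_nf
  rw [e]
  have h3 := log_one_add_le_rpow_half ht
  have h4 := log_one_add_log_one_add_le_rpow ht
  gcongr

/-- If `1 + y = (1 + u) ^ K`, the logarithmic part of `Φ_{p,q,r}` at `y` is at most `K ^ (q + r)`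
times its value at `u`. -/
lemma log_rpow_mul_loglog_rpow_le {q r K u y : ℝ} (hr : 0 ≤ r) (hK : 1 ≤ K)
    (hu : 0 ≤ u) (hy : 1 + y = (1 + u) ^ K) :
    log (1 + y) ^ q * log (1 + log (1 + y)) ^ r ≤
      K ^ (q + r) * (log (1 + u) ^ q * log (1 + log (1 + u)) ^ r) := by
  have h1 := log_one_add_nonneg hu
  have h2 := log_one_add_nonneg h1
  have hK0 : 0 < K := by linarith
  rw [hy, log_rpow (by linarith)]
  have e : K ^ (q + r) * (log (1 + u) ^ q * log (1 + log (1 + u)) ^ r) =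
      (K * log (1 + u)) ^ q * (K * log (1 + log (1 + u))) ^ r := by
    rw [mul_rpow hK0.le h1, mul_rpow hK0.le h2, rpow_add hK0]
    ring
  rw [e]
  have h3 := log_one_add_mul_le hK h1
  have h4 : 0 ≤ log (1 + K * log (1 + u)) := log_one_add_nonneg (by positivity)
  gcongr

/-- With `Φ_{p,q,r}(t) = t^p·log^q(1+t)·log^r(1+log(1+t))`,
`Ψ(t) = (1/C)·t^{1−1/p}·log^{q/p}(1+t)·log^{r/p}(1+log(1+t))` and
`C = (p+q/2+r/4)^{(q+r)/p}`, for all `a, y ≥ 0` one has `a·Ψ(y) ≤ Φ_{p,q,r}(a) + y`. -/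
theorem stmt_6 (p q r : ℝ) (hp : 1 ≤ p) (hq : 0 ≤ q) (hr : 0 ≤ r)
    (hne : 0 < (p - 1) ^ 2 + q ^ 2 + r ^ 2)
    (C : ℝ) (hC : C = (p + q / 2 + r / 4) ^ ((q + r) / p))
    (Φ Ψ : ℝ → ℝ)
    (hΦ : ∀ t : ℝ, Φ t = t ^ p * (log (1 + t)) ^ q * (log (1 + log (1 + t))) ^ r)
    (hΨ : ∀ t : ℝ, Ψ t = (1 / C) * (t ^ (1 - 1 / p) * (log (1 + t)) ^ (q / p) *
        (log (1 + log (1 + t))) ^ (r / p)))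
    (a y : ℝ) (ha : 0 ≤ a) (hy : 0 ≤ y) :
    a * Ψ y ≤ Φ a + y := by
  rw [hΦ, hΨ, hC, mul_assoc (a ^ p)]
  set K := p + q / 2 + r / 4 with hKdef
  have hK : 1 ≤ K := by linarith
  have hK0 : 0 < K := by linarith
  have hp0 : 0 < p := by linarith
  have hinv : 1 / p ≤ 1 := by rw [div_le_one hp0]; exact hp
  have hinv0 : 0 < 1 / p := by positivity
  have hLy := log_one_add_nonneg hy
  have hMy := log_one_add_nonneg hLy
  have hLa := log_one_add_nonneg ha
  have hMa := log_one_add_nonneg hLa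
  set X := a ^ p * (log (1 + y) ^ q * log (1 + log (1 + y)) ^ r) / K ^ (q + r) with hX
  have hX0 : 0 ≤ X := by positivity
  have hXroot : X ^ (1 / p) =
      a * (log (1 + y) ^ (q / p) * log (1 + log (1 + y)) ^ (r / p)) / K ^ ((q + r) / p) := by
    rw [hX, div_rpow (by positivity) (by positivity), mul_rpow (by positivity) (by positivity),
      mul_rpow (by positivity) (by positivity), ← rpow_mul ha, ← rpow_mul hLy, ← rpow_mul hMy,
      ← rpow_mul hK0.le, mul_one_div_cancel hp0.ne', rpow_one, mul_one_div, mul_one_div,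
      mul_one_div]
  have young := geom_mean_le_arith_mean2_weighted hinv0.le (sub_nonneg.2 hinv) hX0 hy (by ring)
  rw [hXroot] at young
  have bound : 1 / p * X + (1 - 1 / p) * y ≤
      a ^ p * (log (1 + a) ^ q * log (1 + log (1 + a)) ^ r) + y := by
    obtain ⟨u, hu, huy⟩ : ∃ u : ℝ, 0 ≤ u ∧ 1 + y = (1 + u) ^ K := by
      refine ⟨(1 + y) ^ (1 / K) - 1, sub_nonneg.2 (one_le_rpow (by linarith) (by positivity)), ?_⟩
      rw [add_sub_cancel, ← rpow_mul (by linarith), one_div_mul_cancel hK0.ne', rpow_one]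
    have hlog := log_rpow_mul_loglog_rpow_le (q := q) hr hK hu huy
    have hXle : X ≤ a ^ p * (log (1 + u) ^ q * log (1 + log (1 + u)) ^ r) := by
      rw [hX, div_le_iff₀ (by positivity)]
      calc _ ≤ a ^ p * (K ^ (q + r) * (log (1 + u) ^ q * log (1 + log (1 + u)) ^ r)) := by gcongr
        _ = _ := by ring
    have hΦ0 : 0 ≤ a ^ p * (log (1 + a) ^ q * log (1 + log (1 + a)) ^ r) := by positivity
    rcases le_total a u with hau | hua
    · have hXy : X ≤ y := by
        have hLu := log_one_add_nonneg hu
        have hMu := log_one_add_nonneg hLu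
        have h1 : X ≤ u ^ p * (log (1 + u) ^ q * log (1 + log (1 + u)) ^ r) :=
          hXle.trans (by gcongr)
        have h2 := rpow_mul_log_rpow_mul_loglog_rpow_le hp0.le hq hr hu
        have h3 := add_rpow_le_rpow_add zero_le_one hu hK
        rw [one_rpow, ← huy] at h3
        linarith
      nlinarith
    · have hmono := log_rpow_mul_loglog_rpow_mono hq hr hu hua
      have h1 : X ≤ a ^ p * (log (1 + a) ^ q * log (1 + log (1 + a)) ^ r) :=
        hXle.trans (by gcongr)
      nlinarith
  refine le_trans (le_of_eq ?_) (young.trans bound)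
  ring
end

section
/- Fix p ≥ 1 and q, r ≥ 0 with (p−1)² + q² + r² > 0. Then the function Φ_{p,q,r}(t) = t^p · log^q(1+t) · log^r(1 + log(1+t)) is strictly convex on (0, +∞). -/
open Real Set

lemma hasDerivAt_log_one_add {t : ℝ} (ht : 0 < t) :
    HasDerivAt (fun t : ℝ => log (1 + t)) (1 / (1 + t)) t :=
  ((hasDerivAt_id t).const_add 1).log (by simp only [id]; positivity)

lemma log_one_add_pos {t : ℝ} (ht : 0 < t) : 0 < log (1 + t) :=
  log_pos (by linarith)

lemma hasDerivAt_log_one_add_log_one_add {t : ℝ} (ht : 0 < t) :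
    HasDerivAt (fun t : ℝ => log (1 + log (1 + t))) (1 / (1 + t) / (1 + log (1 + t))) t := by
  have hL := log_one_add_pos ht
  exact ((hasDerivAt_log_one_add ht).const_add 1).log (by positivity)

/-- The logarithmic derivative of `t ^ p * log (1 + t) ^ q * log (1 + log (1 + t)) ^ r`. -/
noncomputable def phiLogDeriv (p q r t : ℝ) : ℝ :=
  p * t⁻¹ + q * ((1 + t) * log (1 + t))⁻¹ +
    r * ((1 + t) * (1 + log (1 + t)) * log (1 + log (1 + t)))⁻¹

lemma hasDerivAt_phi (p q r : ℝ) {t : ℝ} (ht : 0 < t) :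
    HasDerivAt (fun t : ℝ => t ^ p * (log (1 + t)) ^ q * (log (1 + log (1 + t))) ^ r)
      (t ^ p * (log (1 + t)) ^ q * (log (1 + log (1 + t))) ^ r * phiLogDeriv p q r t) t := by
  have hL := log_one_add_pos ht
  have hM := log_one_add_pos hL
  have h1 := (hasDerivAt_id t).rpow_const (p := p) (Or.inl ht.ne')
  have h2 := (hasDerivAt_log_one_add ht).rpow_const (p := q) (Or.inl hL.ne')
  have h3 := (hasDerivAt_log_one_add_log_one_add ht).rpow_const (p := r) (Or.inl hM.ne')
  refine ((h1.mul h2).mul h3).congr_deriv ?_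
  simp only [id, phiLogDeriv, Pi.mul_apply, rpow_sub_one ht.ne', rpow_sub_one hL.ne',
    rpow_sub_one hM.ne']
  field_simp

lemma hasDerivAt_phiLogDeriv (p q r : ℝ) {t : ℝ} (ht : 0 < t) :
    HasDerivAt (phiLogDeriv p q r)
      (-(p * t⁻¹ ^ 2 + q * ((1 + t) * log (1 + t))⁻¹ ^ 2 * (log (1 + t) + 1) +
        r * ((1 + t) * (1 + log (1 + t)) * log (1 + log (1 + t)))⁻¹ ^ 2 *
          ((2 + log (1 + t)) * log (1 + log (1 + t)) + 1))) t := by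
  have hL := log_one_add_pos ht
  have hM := log_one_add_pos hL
  have h0 := (hasDerivAt_id t).const_add 1
  have h1 := hasDerivAt_log_one_add ht
  have h2 := hasDerivAt_log_one_add_log_one_add ht
  have a := (hasDerivAt_inv ht.ne').const_mul p
  have b := ((h0.mul h1).inv (by simp only [id, Pi.mul_apply]; positivity)).const_mul q
  have c := (((h0.mul (h1.const_add 1)).mul h2).inv
    (by simp only [id, Pi.mul_apply]; positivity)).const_mul r
  refine ((a.add b).add c).congr_deriv ?_
  simp only [id, Pi.mul_apply]
  field_simp
  ring

lemma phiLogDeriv_sq_add_deriv_pos {p q r : ℝ} (hp : 1 ≤ p) (hq : 0 ≤ q) (hr : 0 ≤ r)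
    (hne : 0 < (p - 1) ^ 2 + q ^ 2 + r ^ 2) {t : ℝ} (ht : 0 < t) :
    0 < phiLogDeriv p q r t ^ 2 +
      -(p * t⁻¹ ^ 2 + q * ((1 + t) * log (1 + t))⁻¹ ^ 2 * (log (1 + t) + 1) +
        r * ((1 + t) * (1 + log (1 + t)) * log (1 + log (1 + t)))⁻¹ ^ 2 *
          ((2 + log (1 + t)) * log (1 + log (1 + t)) + 1)) := by
  have hL := log_one_add_pos ht
  have hM := log_one_add_pos hL
  have hLt := le_log_one_add_of_nonneg ht.le
  have hML := le_log_one_add_of_nonneg hL.le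
  unfold phiLogDeriv
  set L := log (1 + t)
  set M := log (1 + L)
  rw [div_le_iff₀ (by positivity)] at hLt hML
  have hb : 0 < 2 * t⁻¹ - ((1 + t) * L)⁻¹ * (L + 1) := by
    have : 2 * t⁻¹ - ((1 + t) * L)⁻¹ * (L + 1)
        = (2 * ((1 + t) * L) - t * (L + 1)) / (t * ((1 + t) * L)) := by field_simp
    rw [this]
    apply div_pos _ (by positivity)
    nlinarith
  have hc : 0 < 2 * t⁻¹ - ((1 + t) * (1 + L) * M)⁻¹ * ((2 + L) * M + 1) := by
    have : 2 * t⁻¹ - ((1 + t) * (1 + L) * M)⁻¹ * ((2 + L) * M + 1)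
        = (2 * ((1 + t) * (1 + L) * M) - t * ((2 + L) * M + 1)) /
          (t * ((1 + t) * (1 + L) * M)) := by field_simp
    rw [this]
    apply div_pos _ (by positivity)
    have h1 : 0 < 2 * L * (2 + 2 * L + t * L) - t * (L + 2) := by
      nlinarith [mul_le_mul_of_nonneg_left hLt hL.le, mul_pos hL ht]
    have h2 : 0 < (M * (2 + 2 * L + t * L) - t) * (L + 2) := by
      nlinarith [mul_le_mul_of_nonneg_right hML (by positivity : 0 ≤ 2 + 2 * L + t * L)]
    linarith [pos_of_mul_pos_left h2 (by positivity)]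
  have ha : 0 < t⁻¹ := by positivity
  have hb0 : 0 < ((1 + t) * L)⁻¹ := by positivity
  have hc0 : 0 < ((1 + t) * (1 + L) * M)⁻¹ := by positivity
  have hK : 0 < (2 + L) * M + 1 := by positivity
  generalize t⁻¹ = a at *
  generalize ((1 + t) * L)⁻¹ = b at *
  generalize ((1 + t) * (1 + L) * M)⁻¹ = c at *
  generalize (2 + L) * M + 1 = K at *
  have hp1 : 0 ≤ p - 1 := by linarith
  have key : 0 < p * (p - 1) * a ^ 2 + q * (b * (2 * a - b * (L + 1))) +
      r * (c * (2 * a - c * K)) := by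
    have e1 : 0 ≤ p * (p - 1) * a ^ 2 := by positivity
    have e2 : 0 ≤ q * (b * (2 * a - b * (L + 1))) := by positivity
    have e3 : 0 ≤ r * (c * (2 * a - c * K)) := by positivity
    rcases hp1.lt_or_eq with h | h
    · have : 0 < p * (p - 1) * a ^ 2 := by positivity
      linarith
    rcases hq.lt_or_eq with h' | h'
    · have : 0 < q * (b * (2 * a - b * (L + 1))) := by positivity
      linarith
    rcases hr.lt_or_eq with h'' | h''
    · have : 0 < r * (c * (2 * a - c * K)) := by positivity
      linarith
    · simp [← h, ← h', ← h''] at hne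
  have rest : 0 ≤ 2 * (p - 1) * a * (q * b + r * c) + (q * b + r * c) ^ 2 := by positivity
  linarith

/-- for `p ≥ 1`, `q, r ≥ 0` with `(p−1)² + q² + r² > 0`, the function
`Φ_{p,q,r}(t) = t^p · log^q(1+t) · log^r(1+log(1+t))` is strictly convex on `(0, ∞)`. -/
theorem stmt_16 (p q r : ℝ) (hp : 1 ≤ p) (hq : 0 ≤ q) (hr : 0 ≤ r)
    (hne : 0 < (p - 1) ^ 2 + q ^ 2 + r ^ 2) :
    StrictConvexOn ℝ (Ioi (0:ℝ)) (fun t : ℝ =>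
      t ^ p * (log (1 + t)) ^ q * (log (1 + log (1 + t))) ^ r) := by
  refine strictConvexOn_of_deriv2_pos' (convex_Ioi 0)
    (fun t ht => (hasDerivAt_phi p q r ht).continuousAt.continuousWithinAt) fun t ht => ?_
  have hd := (hasDerivAt_phi p q r ht).mul (hasDerivAt_phiLogDeriv p q r ht)
  have he : deriv (fun t : ℝ => t ^ p * (log (1 + t)) ^ q * (log (1 + log (1 + t))) ^ r)
      =ᶠ[nhds t] (fun t : ℝ => t ^ p * (log (1 + t)) ^ q * (log (1 + log (1 + t))) ^ r) *
        phiLogDeriv p q r := by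
    filter_upwards [Ioi_mem_nhds ht] with s hs using (hasDerivAt_phi p q r hs).deriv
  rw [Function.iterate_succ_apply, Function.iterate_one, he.deriv_eq, hd.deriv, mul_assoc,
    ← mul_add, ← sq]
  have ht' : 0 < t := ht
  have hL := log_one_add_pos ht'
  have hM := log_one_add_pos hL
  exact mul_pos (by positivity) (phiLogDeriv_sq_add_deriv_pos hp hq hr hne ht')
end
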